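/- arXiv:2104.06971 — 3 statements merged into one kernel-verified Lean document; each statement's English description precedes it below -/
import Mathlib

section
/- Let r ≥ 3 be an odd integer and let G be a finite simple graph containing no cycle of length r. Let z be a vertex of G, let R ⊆ V(G) \ {z}, and let j be a positive integer with j ≤ (r−1)/2. Define an auxiliary graph H on vertex set R in which two distinct vertices u, v ∈ R are adjacent if and only if G contains a cycle of length 2j+1 of the form z, u₁, u₂, …, u_{j−1}, u, v, v_{j−1}, …, v₁, z (all 2j+1 vertices distinct, consecutive vertices adjacent in G, and u adjacent to v) with u₁, …, u_{j−1}, v₁, …, v_{j−1} ∉ R. Then H has average degree at most 2^(2j+1)·(r−2j), i.e., 2·e(H) ≤ 2^(2j+1)·(r−2j)·|R|. -/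
namespace MaxCutPaper

variable {V : Type*}

/-- The size of the cut induced by a vertex subset `S`: the number of edges of `G`
with one endpoint in `S` and the other outside `S` (counted via ordered pairs with
first coordinate in `S`). -/
noncomputable def cutSize [Fintype V] (G : SimpleGraph V) (S : Finset V) : ℕ :=
  Nat.card {p : V × V // p.1 ∈ S ∧ p.2 ∉ S ∧ G.Adj p.1 p.2}

/-- The maximum size of a cut of `G`. -/
noncomputable def maxCut [Fintype V] (G : SimpleGraph V) : ℕ :=
  (Finset.univ : Finset V).powerset.sup (cutSize G)

/-- The number of edges of `G`. -/
noncomputable def edgeCount (G : SimpleGraph V) : ℕ := Nat.card G.edgeSet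

/-- The surplus of `G`: `mc(G) - e(G)/2`. -/
noncomputable def surplus [Fintype V] (G : SimpleGraph V) : ℝ :=
  (maxCut G : ℝ) - (edgeCount G : ℝ) / 2

/-- The degree of a vertex. -/
noncomputable def degC (G : SimpleGraph V) (v : V) : ℕ := Nat.card (G.neighborSet v)

/-- The number of copies of `K_r` in `G`, i.e. `r`-element sets of pairwise adjacent
vertices. -/
noncomputable def cliqueCount (G : SimpleGraph V) (r : ℕ) : ℕ :=
  Nat.card {s : Finset V // G.IsNClique r s}

/-- `G` contains no cycle of length `r`. -/
def CycleFree (G : SimpleGraph V) (r : ℕ) : Prop :=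
  ∀ ⦃v : V⦄ (w : G.Walk v v), w.IsCycle → w.length ≠ r

/-- `G` is `d`-degenerate (for a real `d ≥ 0`): every (induced) subgraph has a vertex of
degree at most `d`. -/
def Degenerate (G : SimpleGraph V) (d : ℝ) : Prop :=
  ∀ B : Finset V, B.Nonempty → ∃ v ∈ B, (Nat.card {u : V // u ∈ B ∧ G.Adj v u} : ℝ) ≤ d

/-- The number of edges of `G` with both endpoints in `T`. -/
noncomputable def edgesIn (G : SimpleGraph V) (T : Finset V) : ℝ :=
  (Nat.card {p : V × V // p.1 ∈ T ∧ p.2 ∈ T ∧ G.Adj p.1 p.2} : ℝ) / 2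

/-- `hasSpecialCycle G j z R u v` says that `G` contains a cycle of length `2j+1` of
the form `z, u₁, …, u_{j-1}, u, v, v_{j-1}, …, v₁, z` (all `2j+1` vertices distinct,
consecutive ones adjacent, the last adjacent to the first) with
`u₁, …, u_{j-1}, v₁, …, v₁ ∉ R`. The cycle is encoded by `w : ℕ → V`, injective on
`{0, …, 2j}`, with `w 0 = z`, `w j = u`, `w (j+1) = v`; the vertices `w i` for
`1 ≤ i ≤ j-1` and `j+2 ≤ i ≤ 2j` are required to avoid `R`. -/
def hasSpecialCycle (G : SimpleGraph V) (j : ℕ) (z : V) (R : Finset V)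
    (u v : V) : Prop :=
  ∃ w : ℕ → V,
    (∀ i₁ i₂, i₁ ≤ 2 * j → i₂ ≤ 2 * j → w i₁ = w i₂ → i₁ = i₂) ∧
    w 0 = z ∧ w j = u ∧ w (j + 1) = v ∧
    (∀ i < 2 * j, G.Adj (w i) (w (i + 1))) ∧
    G.Adj (w (2 * j)) (w 0) ∧
    (∀ i, 1 ≤ i → i + 1 ≤ j → w i ∉ R) ∧
    (∀ i, j + 2 ≤ i → i ≤ 2 * j → w i ∉ R)

/-- A graph whose vertices in `R` all have at least `k` neighbours in `R` contains a path of
length `k` inside `R`. -/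
lemma exists_isPath_of_le_degree [DecidableEq V] (K : SimpleGraph V) [DecidableRel K.Adj]
    (R : Finset V) (hR : R.Nonempty) (k : ℕ) (hk : ∀ v ∈ R, k ≤ (R.filter (K.Adj v)).card) :
    ∃ (a b : V) (p : K.Walk a b), p.IsPath ∧ p.length = k ∧ ∀ x ∈ p.support, x ∈ R := by
  suffices h : ∀ m ≤ k, ∃ (a b : V) (p : K.Walk a b), p.IsPath ∧ p.length = m ∧
      ∀ x ∈ p.support, x ∈ R from h k le_rfl
  intro m
  induction m with
  | zero =>
    obtain ⟨v, hv⟩ := hR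
    exact fun _ ↦ ⟨v, v, .nil, by simp [hv]⟩
  | succ m ih =>
    intro hm
    obtain ⟨a, b, p, hp, hl, hs⟩ := ih (by lia)
    obtain ⟨x, hx, hxp⟩ : ∃ x ∈ R.filter (K.Adj a), x ∉ p.support := by
      by_contra! hcon
      have hsub : R.filter (K.Adj a) ⊆ p.support.toFinset.erase a := fun x hx ↦
        Finset.mem_erase.2 ⟨(Finset.mem_filter.1 hx).2.ne', List.mem_toFinset.2 (hcon x hx)⟩
      have h₁ := Finset.card_le_card hsub
      rw [Finset.card_erase_of_mem (by simp), List.toFinset_card_of_nodup hp.support_nodup,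
        SimpleGraph.Walk.length_support] at h₁
      have h₂ := hk a (hs a p.start_mem_support)
      lia
    rw [Finset.mem_filter] at hx
    refine ⟨x, b, .cons hx.2.symm p, hp.cons hxp, by simp [hl], ?_⟩
    simpa [hx.1] using hs

/-- A graph in which `R` spans more than `2 * k * #R` ordered pairs of adjacent vertices contains
a path of length `k` inside `R`. -/
lemma exists_isPath_of_card_lt [DecidableEq V] (K : SimpleGraph V) [DecidableRel K.Adj]
    (k : ℕ) (R : Finset V)
    (h : 2 * k * R.card < ((R ×ˢ R).filter fun p ↦ K.Adj p.1 p.2).card) :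
    ∃ (a b : V) (p : K.Walk a b), p.IsPath ∧ p.length = k ∧ ∀ x ∈ p.support, x ∈ R := by
  induction R using Finset.strongInduction with
  | H R ih =>
    by_cases hd : ∀ v ∈ R, k ≤ (R.filter (K.Adj v)).card
    · refine exists_isPath_of_le_degree K R ?_ k hd
      rw [Finset.nonempty_iff_ne_empty]
      rintro rfl
      simp at h
    · push Not at hd
      obtain ⟨v, hv, hlt⟩ := hd
      have hsub : ((R ×ˢ R).filter fun p ↦ K.Adj p.1 p.2) ⊆
          ((R.erase v ×ˢ R.erase v).filter fun p ↦ K.Adj p.1 p.2) ∪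
            ((R.filter (K.Adj v)).image (fun x ↦ (v, x)) ∪
              (R.filter (K.Adj v)).image (fun x ↦ (x, v))) := by
        rintro ⟨x, y⟩ hxy
        have := K.adj_comm x y
        simp only [Finset.mem_filter, Finset.mem_product, Finset.mem_union, Finset.mem_image,
          Finset.mem_erase, Prod.mk.injEq] at hxy ⊢
        grind
      have h₁ := (Finset.card_le_card hsub).trans
        ((Finset.card_union_le _ _).trans (Nat.add_le_add_left (Finset.card_union_le _ _) _))
      have h₂ := Finset.card_image_le (s := R.filter (K.Adj v)) (f := fun x ↦ (v, x))
      have h₃ := Finset.card_image_le (s := R.filter (K.Adj v)) (f := fun x ↦ (x, v))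
      have h₄ := Finset.card_erase_add_one hv
      obtain ⟨a, b, p, hp, hl, hs⟩ := ih (R.erase v) (Finset.erase_ssubset hv) (by
        rw [← h₄, mul_add] at h
        lia)
      exact ⟨a, b, p, hp, hl, fun x hx ↦ Finset.mem_of_mem_erase (hs x hx)⟩

lemma exists_isPath_of_injOn (G : SimpleGraph V) (w : ℕ → V) (n : ℕ)
    (hw : Set.InjOn w (Set.Iic n)) (hadj : ∀ i < n, G.Adj (w i) (w (i + 1))) :
    ∃ p : G.Walk (w 0) (w n), p.IsPath ∧ p.length = n ∧
      ∀ x ∈ p.support, ∃ i ≤ n, x = w i := by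
  induction n with
  | zero => exact ⟨.nil, by simp⟩
  | succ n ih =>
    obtain ⟨p, hp, hl, hs⟩ := ih (hw.mono (Set.Iic_subset_Iic.2 n.le_succ))
      fun i hi ↦ hadj i (by lia)
    refine ⟨p.concat (hadj n n.lt_succ_self), hp.concat ?_ _, by simp [hl], ?_⟩
    · intro hmem
      obtain ⟨i, hi, he⟩ := hs _ hmem
      have := hw (Set.mem_Iic.2 le_rfl) (Set.mem_Iic.2 (by lia)) he
      lia
    · intro x hx
      rw [SimpleGraph.Walk.support_concat, List.mem_append, List.mem_singleton] at hx
      rcases hx with hx | rfl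
      · obtain ⟨i, hi, he⟩ := hs x hx
        exact ⟨i, by lia, he⟩
      · exact ⟨n + 1, le_rfl, rfl⟩

/-- The set `c` contains the half `w 1, …, w j` and avoids the half `w (j + 1), …, w (2 * j)` of
the cycle `w`. -/
def Splits (c : Finset V) (j : ℕ) (w : ℕ → V) : Prop :=
  (∀ i, 1 ≤ i → i ≤ j → w i ∈ c) ∧ ∀ i, j + 1 ≤ i → i ≤ 2 * j → w i ∉ c

/-- The condition that `w` is a cycle witnessing `hasSpecialCycle G j z R u v`. -/
def IsSpecialCycle (G : SimpleGraph V) (j : ℕ) (z : V) (R : Finset V) (u v : V)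
    (w : ℕ → V) : Prop :=
  (∀ i₁ i₂, i₁ ≤ 2 * j → i₂ ≤ 2 * j → w i₁ = w i₂ → i₁ = i₂) ∧
    w 0 = z ∧ w j = u ∧ w (j + 1) = v ∧
    (∀ i < 2 * j, G.Adj (w i) (w (i + 1))) ∧
    G.Adj (w (2 * j)) (w 0) ∧
    (∀ i, 1 ≤ i → i + 1 ≤ j → w i ∉ R) ∧
    (∀ i, j + 2 ≤ i → i ≤ 2 * j → w i ∉ R)

section Splitting

variable {G : SimpleGraph V} {j : ℕ} {z u v : V} {R c : Finset V} {w : ℕ → V}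

lemma IsSpecialCycle.exists_isPath_left (h : IsSpecialCycle G j z R u v w) (hc : Splits c j w)
    (hz : z ∉ R) :
    ∃ p : G.Walk z u, p.IsPath ∧ p.length = j ∧ (∀ x ∈ p.support, x ≠ z → x ∈ c) ∧
      ∀ x ∈ p.support, x ∈ R → x = u := by
  obtain ⟨hinj, rfl, rfl, -, hadj, -, hR, -⟩ := h
  obtain ⟨p, hp, hl, hs⟩ := exists_isPath_of_injOn G w j
    (fun a ha b hb ↦ hinj a b (by grind) (by grind)) fun i hi ↦ hadj i (by lia)
  refine ⟨p, hp, hl, fun x hx hxz ↦ ?_, fun x hx hxR ↦ ?_⟩ <;> obtain ⟨i, hi, rfl⟩ := hs x hx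
  · have : i ≠ 0 := by rintro rfl; exact hxz rfl
    exact hc.1 i (by lia) hi
  · have : i ≠ 0 := by rintro rfl; exact hz hxR
    by_contra hne
    have : i ≠ j := by rintro rfl; exact hne rfl
    exact hR i (by lia) (by lia) hxR

lemma IsSpecialCycle.exists_isPath_right (h : IsSpecialCycle G j z R u v w) (hc : Splits c j w)
    (hz : z ∉ R) (hj : 1 ≤ j) :
    ∃ p : G.Walk z v, p.IsPath ∧ p.length = j ∧ (∀ x ∈ p.support, x ≠ z → x ∉ c) ∧
      ∀ x ∈ p.support, x ∈ R → x = v := by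
  obtain ⟨hinj, rfl, -, rfl, hadj, hlast, -, hR⟩ := h
  let w' : ℕ → V := fun i ↦ if i = 0 then w 0 else w (2 * j + 1 - i)
  have hpos (i : ℕ) (hi : i ≠ 0) : w' i = w (2 * j + 1 - i) := if_neg hi
  have hend : w' j = w (j + 1) := by rw [hpos j (by lia)]; congr 1; lia
  have hinj' : Set.InjOn w' (Set.Iic j) := by
    intro a ha b hb hab
    rw [Set.mem_Iic] at ha hb
    simp only [w'] at hab
    split_ifs at hab <;> have := hinj _ _ (by lia) (by lia) hab <;> lia
  obtain ⟨p, hp, hl, hs⟩ := exists_isPath_of_injOn G w' j hinj' (by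
    intro i hi
    rw [hpos (i + 1) (by lia)]
    rcases Nat.eq_zero_or_pos i with rfl | hi₀
    · exact hlast.symm
    · rw [hpos i (by lia), show 2 * j + 1 - i = 2 * j + 1 - (i + 1) + 1 by lia]
      exact (hadj _ (by lia)).symm)
  refine ⟨p.copy rfl hend, by simpa using hp, by simpa using hl, fun x hx hxz ↦ ?_,
    fun x hx hxR ↦ ?_⟩ <;> rw [SimpleGraph.Walk.support_copy] at hx <;>
    obtain ⟨i, hi, rfl⟩ := hs x hx
  · have : i ≠ 0 := by rintro rfl; exact hxz rfl
    rw [hpos i this]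
    exact hc.2 _ (by lia) (by lia)
  · have : i ≠ 0 := by rintro rfl; exact hz hxR
    by_contra hne
    have : i ≠ j := by rintro rfl; exact hne hend
    rw [hpos i (by lia)] at hxR
    exact hR _ (by lia) (by lia) hxR

/-- Two paths from `z`, one inside `c` and one outside, close up with a path inside `R` to a
cycle. -/
lemma exists_isCycle_of_isPath {a b : V} {m : ℕ} {P : G.Walk z a} {Q : G.Walk z b}
    {p : G.Walk a b} (hP : P.IsPath) (hQ : Q.IsPath) (hp : p.IsPath)
    (hPl : P.length = m) (hQl : Q.length = m) (hm : 1 ≤ m)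
    (hPc : ∀ x ∈ P.support, x ≠ z → x ∈ c) (hQc : ∀ x ∈ Q.support, x ≠ z → x ∉ c)
    (hPR : ∀ x ∈ P.support, x ∈ R → x = a) (hQR : ∀ x ∈ Q.support, x ∈ R → x = b)
    (hpR : ∀ x ∈ p.support, x ∈ R) :
    ∃ q : G.Walk a a, q.IsCycle ∧ q.length = p.length + 2 * m := by
  have hpath : (Q.reverse.append P).IsPath := by
    rw [SimpleGraph.Walk.isPath_def, SimpleGraph.Walk.support_append, List.nodup_append']
    refine ⟨hQ.reverse.support_nodup, hP.support_nodup.tail, fun x hxQ hxP ↦ ?_⟩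
    have hn := hP.support_nodup
    rw [← SimpleGraph.Walk.cons_tail_support, List.nodup_cons] at hn
    have hxz : x ≠ z := by rintro rfl; exact hn.1 hxP
    rw [SimpleGraph.Walk.support_reverse, List.mem_reverse] at hxQ
    exact hQc x hxQ hxz (hPc x (List.mem_of_mem_tail hxP) hxz)
  refine ⟨p.append (Q.reverse.append P), hp.isCycle_append hpath (fun x hxp hx ↦ ?_) (.inr ?_), ?_⟩
  · have hxR := hpR x (List.mem_of_mem_tail hxp)
    have hna := hp.support_nodup
    have hnb := hpath.support_nodup
    rw [← SimpleGraph.Walk.cons_tail_support, List.nodup_cons] at hna hnb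
    have hmem := List.mem_of_mem_tail hx
    rw [SimpleGraph.Walk.mem_support_append_iff, SimpleGraph.Walk.support_reverse,
      List.mem_reverse] at hmem
    rcases hmem with hmem | hmem
    · exact hnb.1 (hQR x hmem hxR ▸ hx)
    · exact hna.1 (hPR x hmem hxR ▸ hxp)
  · simp [hPl, hQl]; lia
  · simp [hPl, hQl]; lia

/-- In a `C_{k+2j}`-free graph with `k` odd, few pairs in `R` are joined by a special cycle split
by a fixed set `c`. -/
lemma card_le_of_splits [DecidableEq V] {k : ℕ} (hk : Odd k) (hG : CycleFree G (k + 2 * j))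
    (hz : z ∉ R) (hj : 1 ≤ j) (c : Finset V) (D : Finset (V × V)) (hDR : D ⊆ R ×ˢ R)
    (hD : ∀ p ∈ D, ∃ w, IsSpecialCycle G j z R p.1 p.2 w ∧ Splits c j w) :
    D.card ≤ 2 * k * R.card := by
  classical
  have hDc : ∀ p ∈ D, p.1 ∈ c ∧ p.2 ∉ c ∧ G.Adj p.1 p.2 := by
    intro p hp
    obtain ⟨w, ⟨-, -, h₁, h₂, hadj, -⟩, hc⟩ := hD p hp
    rw [← h₁, ← h₂]
    exact ⟨hc.1 j hj le_rfl, hc.2 (j + 1) le_rfl (by lia), hadj j (by lia)⟩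
  let K : SimpleGraph V :=
    { Adj := fun u v ↦ (u, v) ∈ D ∨ (v, u) ∈ D
      symm := ⟨fun _ _ ↦ Or.symm⟩
      loopless := ⟨fun u h ↦ by
        have := hDc (u, u) (h.elim id id)
        exact this.2.1 this.1⟩ }
  have hKG : K ≤ G := by
    rintro u v (h | h)
    · exact (hDc _ h).2.2
    · exact (hDc _ h).2.2.symm
  let col : K.Coloring Bool := SimpleGraph.Coloring.mk (fun v ↦ decide (v ∈ c)) (by
    rintro u v (h | h) <;> have := hDc _ h <;> simp_all)
  have hcol (x : V) : col x = true ↔ x ∈ c := decide_eq_true_iff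
  have hpar {a b : V} (p : K.Walk a b) (hp : Odd p.length) : a ∉ c ↔ b ∈ c := by
    rw [← hcol, ← hcol]
    exact (col.odd_length_iff_not_congr p).1 hp
  by_contra! hcon
  have hsub : D ⊆ (R ×ˢ R).filter fun p ↦ K.Adj p.1 p.2 := fun p hp ↦
    Finset.mem_filter.2 ⟨hDR hp, .inl hp⟩
  obtain ⟨a, b, p, hp, hl, hs⟩ :=
    exists_isPath_of_card_lt K k R (hcon.trans_le (Finset.card_le_card hsub))
  wlog ha : a ∈ c generalizing a b
  · refine this b a p.reverse hp.reverse (by simpa using hl) (by simpa using hs) ?_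
    exact (hpar p (hl ▸ hk)).1 ha
  have hb : b ∉ c := fun hb ↦ (hpar p (hl ▸ hk)).2 hb ha
  have hnil : ¬ p.Nil := fun h ↦ by
    rw [← SimpleGraph.Walk.length_eq_zero_iff] at h
    rw [← hl, h] at hk
    simp at hk
  obtain ⟨w₁, hw₁, hc₁⟩ := hD (a, p.snd) ((p.adj_snd hnil).resolve_right
    fun h ↦ (hDc _ h).2.1 ha)
  obtain ⟨w₂, hw₂, hc₂⟩ := hD (p.penultimate, b) ((p.adj_penultimate hnil).resolve_right
    fun h ↦ hb (hDc _ h).1)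
  obtain ⟨P, hP, hPl, hPc, hPR⟩ := hw₁.exists_isPath_left hc₁ hz
  obtain ⟨Q, hQ, hQl, hQc, hQR⟩ := hw₂.exists_isPath_right hc₂ hz hj
  obtain ⟨q, hq, hql⟩ := exists_isCycle_of_isPath (p := p.mapLe hKG) hP hQ (hp.mapLe hKG)
    hPl hQl hj hPc hQc hPR hQR (by simpa using hs)
  exact hG q hq (by simp [hql, hl])

lemma card_filter_splits [DecidableEq V] (T : Finset V) [DecidablePred fun c ↦ Splits c j w]
    (hinj : ∀ i₁ i₂, i₁ ≤ 2 * j → i₂ ≤ 2 * j → w i₁ = w i₂ → i₁ = i₂)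
    (hT : ∀ i ≤ 2 * j, w i ∈ T) :
    2 ^ T.card ≤ 2 ^ (2 * j) * (T.powerset.filter fun c ↦ Splits c j w).card := by
  set A := (Finset.Icc 1 j).image w with hA
  set B := (Finset.Icc (j + 1) (2 * j)).image w with hB
  have hcA : A.card ≤ j := Finset.card_image_le.trans (by simp)
  have hcB : B.card ≤ j := Finset.card_image_le.trans (by simp; lia)
  have hAB : A ⊆ T \ B := by
    intro x hx
    simp only [hA, hB, Finset.mem_image, Finset.mem_Icc, Finset.mem_sdiff] at hx ⊢
    obtain ⟨i, hi, rfl⟩ := hx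
    refine ⟨hT i (by lia), ?_⟩
    rintro ⟨i', hi', he⟩
    have := hinj _ _ (by lia) (by lia) he
    lia
  have hsub : Finset.Icc A (T \ B) ⊆ T.powerset.filter fun c ↦ Splits c j w := by
    intro c hc
    rw [Finset.mem_Icc] at hc
    rw [Finset.mem_filter, Finset.mem_powerset]
    refine ⟨hc.2.trans Finset.sdiff_subset, fun i h₁ h₂ ↦ hc.1 ?_, fun i h₁ h₂ hi ↦ ?_⟩
    · exact Finset.mem_image_of_mem _ (Finset.mem_Icc.2 ⟨h₁, h₂⟩)
    · exact (Finset.mem_sdiff.1 (hc.2 hi)).2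
        (Finset.mem_image_of_mem _ (Finset.mem_Icc.2 ⟨h₁, h₂⟩))
  have hle := Finset.card_le_card hsub
  rw [Finset.card_Icc_finset hAB] at hle
  have := Finset.le_card_sdiff B T
  calc 2 ^ T.card ≤ 2 ^ (2 * j + ((T \ B).card - A.card)) :=
        Nat.pow_le_pow_right two_pos (by lia)
    _ ≤ _ := by rw [pow_add]; exact Nat.mul_le_mul_left _ hle

end Splitting

/-- If `G` is `C_r`-free (`r ≥ 3` odd), `z ∈ V`, `R ⊆ V \ {z}` and `1 ≤ j ≤ (r-1)/2`,
then the auxiliary graph `H` on `R`, where `u, v` are adjacent iff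
`hasSpecialCycle G j z R u v`, has average degree at most `2^(2j+1)·(r-2j)`, i.e.
`2·e(H) ≤ 2^(2j+1)·(r-2j)·|R|`. Here `2·e(H)` is the number of ordered pairs of
adjacent vertices of `H` (the relation `hasSpecialCycle` is symmetric in `u, v`). -/
theorem statement17 (r : ℕ) (hr : 3 ≤ r) (hodd : Odd r) (V : Type)
    (G : SimpleGraph V) (hG : CycleFree G r) (z : V) (R : Finset V) (hz : z ∉ R)
    (j : ℕ) (hj : 1 ≤ j) (hjr : 2 * j + 1 ≤ r) :
    Nat.card {p : V × V // p.1 ∈ R ∧ p.2 ∈ R ∧ hasSpecialCycle G j z R p.1 p.2} ≤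
      2 ^ (2 * j + 1) * (r - 2 * j) * R.card := by
  classical
  set D := (R ×ˢ R).filter fun p ↦ hasSpecialCycle G j z R p.1 p.2 with hD
  have hcard : Nat.card {p : V × V // p.1 ∈ R ∧ p.2 ∈ R ∧ hasSpecialCycle G j z R p.1 p.2} =
      D.card := by
    exact Nat.subtype_card D fun p ↦ by simp [hD, and_assoc]
  rw [hcard]
  have hex : ∀ p : V × V, ∃ w, p ∈ D → IsSpecialCycle G j z R p.1 p.2 w := by
    intro p
    by_cases hp : p ∈ D
    · obtain ⟨w, hw⟩ := (Finset.mem_filter.1 hp).2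
      exact ⟨w, fun _ ↦ hw⟩
    · exact ⟨fun _ ↦ z, fun h ↦ absurd h hp⟩
  choose w hw using hex
  set T := D.biUnion fun p ↦ (Finset.range (2 * j + 1)).image (w p)
  have hsum := Finset.sum_card_bipartiteAbove_eq_sum_card_bipartiteBelow (s := D)
    (t := T.powerset) fun p c ↦ Splits c j (w p)
  have hlow : D.card * 2 ^ T.card ≤
      2 ^ (2 * j) * ∑ p ∈ D, (T.powerset.bipartiteAbove (fun p c ↦ Splits c j (w p)) p).card := by
    rw [Finset.mul_sum, ← smul_eq_mul]
    refine Finset.card_nsmul_le_sum _ _ _ fun p hp ↦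
      card_filter_splits T (hw p hp).1 fun i hi ↦ ?_
    exact Finset.mem_biUnion.2 ⟨p, hp, Finset.mem_image_of_mem _ (Finset.mem_range.2 (by lia))⟩
  have hup : ∑ c ∈ T.powerset, (D.bipartiteBelow (fun p c ↦ Splits c j (w p)) c).card ≤
      2 ^ T.card * (2 * (r - 2 * j) * R.card) := by
    rw [← Finset.card_powerset, ← smul_eq_mul]
    refine Finset.sum_le_card_nsmul _ _ _ fun c _ ↦ ?_
    refine card_le_of_splits (G := G) (j := j) (z := z) (by grind) (by
      rwa [Nat.sub_add_cancel (by lia)]) hz hj c _ ?_ ?_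
    · exact (Finset.filter_subset _ _).trans (Finset.filter_subset _ _)
    · intro p hp
      obtain ⟨hp, hc⟩ := Finset.mem_filter.1 hp
      exact ⟨w p, hw p hp, hc⟩
  rw [hsum] at hlow
  refine Nat.le_of_mul_le_mul_right ?_ (Nat.two_pow_pos T.card)
  calc D.card * 2 ^ T.card ≤ _ := hlow.trans (Nat.mul_le_mul_left _ hup)
    _ = _ := by ring

end MaxCutPaper
end

section
/- There exists an absolute constant c > 0 with the following property. Let H be a finite simple graph on N ≥ 1 vertices and let D > 0 be a real number. For each vertex z of H, set Δ₊(z) = max(d_H(z) − D, 0), where d_H(z) is the degree of z in H. If e(H) ≤ N·D/2 + (c/D²)·Σ_{z ∈ V(H), d_H(z) ≤ 20D} Δ₊(z)³, then there exists a subset T ⊆ V(H) such that e_H(T) ≤ (|T|²/2)·(D/N) − (c/D²)·Σ_{z ∈ V(H), d_H(z) ≤ 20D} Δ₊(z)³, where e_H(T) denotes the number of edges of H with both endpoints in T. -/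
namespace MaxCutPaper

variable {V : Type*}

open Matrix in
/-- A quadratic form whose diagonal entries are nonpositive attains its minimum over the
unit cube at a vertex of the cube. -/
theorem exists_indicator_quadratic_le [Fintype V] [DecidableEq V] (M : Matrix V V ℝ)
    (hM : ∀ z, M z z ≤ 0) (x : V → ℝ) (h0 : ∀ z, 0 ≤ x z) (h1 : ∀ z, x z ≤ 1) :
    ∃ T : Finset V,
      (fun z => if z ∈ T then (1 : ℝ) else 0) ⬝ᵥ M *ᵥ (fun z => if z ∈ T then (1 : ℝ) else 0) ≤
        x ⬝ᵥ M *ᵥ x := by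
  have rounding (s : Finset V) : ∃ y : V → ℝ, (∀ z, 0 ≤ y z) ∧ (∀ z, y z ≤ 1) ∧
      (∀ z ∈ s, y z = 0 ∨ y z = 1) ∧ y ⬝ᵥ M *ᵥ y ≤ x ⬝ᵥ M *ᵥ x := by
    induction s using Finset.induction_on with
    | empty => exact ⟨x, h0, h1, by simp, le_rfl⟩
    | insert z s _ ih =>
      obtain ⟨y, hy0, hy1, hys, hyx⟩ := ih
      have expand (r : ℝ) : (y + r • Pi.single z 1) ⬝ᵥ M *ᵥ (y + r • Pi.single z 1) =
          y ⬝ᵥ M *ᵥ y + r * ((y ⬝ᵥ M *ᵥ Pi.single z 1) + (Pi.single z 1 ⬝ᵥ M *ᵥ y)) +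
            r ^ 2 * M z z := by
        have hzz : (Pi.single z 1 : V → ℝ) ⬝ᵥ M *ᵥ Pi.single z 1 = M z z := by simp
        simp only [mulVec_add, mulVec_smul, add_dotProduct, dotProduct_add, smul_dotProduct,
          dotProduct_smul, hzz, smul_eq_mul]
        ring
      set B := (y ⬝ᵥ M *ᵥ Pi.single z 1) + (Pi.single z 1 ⬝ᵥ M *ᵥ y)
      have move (r : ℝ) (hr : y z + r = 0 ∨ y z + r = 1) (hle : r * B ≤ 0) :
          ∃ y : V → ℝ, (∀ z, 0 ≤ y z) ∧ (∀ z, y z ≤ 1) ∧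
            (∀ w ∈ insert z s, y w = 0 ∨ y w = 1) ∧ y ⬝ᵥ M *ᵥ y ≤ x ⬝ᵥ M *ᵥ x := by
        have hz : (y + r • Pi.single z 1 : V → ℝ) z = y z + r := by simp
        have hne (w : V) (hw : w ≠ z) : (y + r • Pi.single z 1 : V → ℝ) w = y w := by simp [hw]
        refine ⟨y + r • Pi.single z 1, fun w => ?_, fun w => ?_, fun w hw => ?_, ?_⟩
        · by_cases h : w = z
          · rw [h, hz]; rcases hr with h | h <;> simp [h]
          · rw [hne w h]; exact hy0 w
        · by_cases h : w = z
          · rw [h, hz]; rcases hr with h | h <;> simp [h]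
          · rw [hne w h]; exact hy1 w
        · by_cases h : w = z
          · rwa [h, hz]
          · rw [hne w h]; exact hys w (Finset.mem_of_mem_insert_of_ne hw h)
        · rw [expand]
          nlinarith [mul_nonneg (sq_nonneg r) (neg_nonneg.2 (hM z))]
      rcases le_total 0 B with hB | hB
      · exact move (-y z) (Or.inl (by ring)) (by nlinarith [hy0 z])
      · exact move (1 - y z) (Or.inr (by ring)) (by nlinarith [hy1 z])
  obtain ⟨y, -, -, hy, hyx⟩ := rounding Finset.univ
  refine ⟨Finset.univ.filter fun z => y z = 1, ?_⟩
  have : (fun z => if z ∈ Finset.univ.filter fun z => y z = 1 then (1 : ℝ) else 0) = y := by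
    funext z
    rcases hy z (Finset.mem_univ z) with h | h <;> simp [h]
  rwa [this]

open Classical in
theorem degC_eq_sum [Fintype V] (H : SimpleGraph V) (u : V) :
    (degC H u : ℝ) = ∑ v, if H.Adj u v then (1 : ℝ) else 0 := by
  rw [degC, Nat.card_eq_fintype_card, SimpleGraph.card_neighborSet_eq_degree,
    ← SimpleGraph.card_neighborFinset_eq_degree, SimpleGraph.neighborFinset_eq_filter]
  simp

theorem sum_degC [Fintype V] (H : SimpleGraph V) :
    ∑ u, (degC H u : ℝ) = 2 * edgeCount H := by
  classical
  have h := H.sum_degrees_eq_twice_card_edges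
  rw [edgeCount, Nat.card_eq_fintype_card, ← SimpleGraph.edgeFinset_card]
  simp only [degC, Nat.card_eq_fintype_card, SimpleGraph.card_neighborSet_eq_degree]
  exact_mod_cast h

open Classical in
theorem two_mul_edgesIn [Fintype V] (H : SimpleGraph V) (T : Finset V) :
    2 * edgesIn H T = ∑ u, ∑ v, (if H.Adj u v then (1 : ℝ) else 0) *
      ((if u ∈ T then 1 else 0) * (if v ∈ T then 1 else 0)) := by
  rw [edgesIn, Nat.card_eq_fintype_card, Fintype.card_subtype, ← Fintype.sum_prod_type',
    Finset.card_filter]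
  push_cast
  rw [mul_div_cancel₀ _ two_ne_zero]
  refine Finset.sum_congr rfl fun p _ => ?_
  by_cases h1 : p.1 ∈ T <;> by_cases h2 : p.2 ∈ T <;> simp [h1, h2]

open Classical in
/-- By `s t ≤ (s² + t²) / 2`, the quadratic form of the adjacency matrix is at most the one of
the diagonal degree matrix, here after splitting off the linear part. -/
theorem sum_adj_mul_one_sub_le [Fintype V] (H : SimpleGraph V) (t : V → ℝ) :
    ∑ u, ∑ v, (if H.Adj u v then (1 : ℝ) else 0) * ((1 - t u) * (1 - t v)) ≤
      ∑ u, (degC H u : ℝ) * (1 - 2 * t u + t u ^ 2) := by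
  have hrow : ∑ u, ∑ v, (if H.Adj u v then (1 : ℝ) else 0) * (1 - 2 * t u + t u ^ 2) =
      ∑ u, (degC H u : ℝ) * (1 - 2 * t u + t u ^ 2) := by
    simp_rw [degC_eq_sum, Finset.sum_mul]
  have hcol : ∑ u, ∑ v, (if H.Adj u v then (1 : ℝ) else 0) * (1 - 2 * t v + t v ^ 2) =
      ∑ u, (degC H u : ℝ) * (1 - 2 * t u + t u ^ 2) := by
    rw [Finset.sum_comm, ← hrow]
    simp_rw [H.adj_comm]
  have hle : 2 * ∑ u, ∑ v, (if H.Adj u v then (1 : ℝ) else 0) * ((1 - t u) * (1 - t v)) ≤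
      ∑ u, ∑ v, (if H.Adj u v then (1 : ℝ) else 0) * (1 - 2 * t u + t u ^ 2) +
        ∑ u, ∑ v, (if H.Adj u v then (1 : ℝ) else 0) * (1 - 2 * t v + t v ^ 2) := by
    simp_rw [Finset.mul_sum, ← Finset.sum_add_distrib]
    refine Finset.sum_le_sum fun u _ => Finset.sum_le_sum fun v _ => ?_
    split_ifs
    · nlinarith [sq_nonneg (t u - t v)]
    · simp
  linarith

/-- The gain at a vertex of degree `d ≤ 20 D` when it is kept with weight
`1 - max (d - D) 0 / (20 D)`. -/
theorem cube_excess_le {d D : ℝ} (hD : 0 < D) (hd : d ≤ 20 * D) :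
    max (d - D) 0 ^ 3 / (380 * D ^ 2) ≤
      2 * (d - D) * (max (d - D) 0 / (20 * D)) - d * (max (d - D) 0 / (20 * D)) ^ 2 := by
  rcases le_total (d - D) 0 with h | h
  · simp [max_eq_right h]
  · rw [max_eq_left h, ← sub_nonneg]
    have key : 2 * (d - D) * ((d - D) / (20 * D)) - d * ((d - D) / (20 * D)) ^ 2 -
        (d - D) ^ 3 / (380 * D ^ 2) =
        (d - D) ^ 2 * (760 * D - 19 * d - 20 * (d - D)) / (7600 * D ^ 2) := by
      field_simp
      ring
    rw [key]
    exact div_nonneg (mul_nonneg (sq_nonneg _) (by linarith)) (by positivity)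

open Classical in
/-- There is an absolute `c > 0` with the following property. Let `H` be a graph on
`N ≥ 1` vertices, `D > 0`, and `Δ₊(z) = max(d_H(z) - D, 0)`. If
`e(H) ≤ N·D/2 + (c/D²)·Σ_{z : d_H(z) ≤ 20D} Δ₊(z)³`, then some `T ⊆ V(H)` satisfies
`e_H(T) ≤ (|T|²/2)·(D/N) - (c/D²)·Σ_{z : d_H(z) ≤ 20D} Δ₊(z)³`. -/
theorem statement18 :
    ∃ c : ℝ, 0 < c ∧
      ∀ (V : Type) [Fintype V] (H : SimpleGraph V) (D : ℝ),
        1 ≤ Fintype.card V → 0 < D →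
        (edgeCount H : ℝ) ≤ (Fintype.card V : ℝ) * D / 2 +
          (c / D ^ 2) * ∑ z : V,
            (if (degC H z : ℝ) ≤ 20 * D then max ((degC H z : ℝ) - D) 0 ^ 3 else 0) →
        ∃ T : Finset V,
          edgesIn H T ≤ (T.card : ℝ) ^ 2 / 2 * (D / (Fintype.card V : ℝ)) -
            (c / D ^ 2) * ∑ z : V,
              (if (degC H z : ℝ) ≤ 20 * D then max ((degC H z : ℝ) - D) 0 ^ 3 else 0) := by
  refine ⟨1 / 1520, by norm_num, fun V _ H D hN hD hE => ?_⟩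
  set N : ℝ := (Fintype.card V : ℝ) with hNdef
  have hNpos : 0 < N := by
    rw [hNdef]
    exact_mod_cast hN
  set S : ℝ := ∑ z : V,
    (if (degC H z : ℝ) ≤ 20 * D then max ((degC H z : ℝ) - D) 0 ^ 3 else 0) with hS
  let t : V → ℝ := fun z =>
    if (degC H z : ℝ) ≤ 20 * D then max ((degC H z : ℝ) - D) 0 / (20 * D) else 0
  have ht0 (z : V) : 0 ≤ t z := by
    simp only [t]
    split_ifs <;> positivity
  have ht1 (z : V) : t z ≤ 1 := by
    simp only [t]
    split_ifs with h
    · rw [div_le_one (by positivity)]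
      exact max_le (by linarith) (by positivity)
    · exact zero_le_one
  let M : Matrix V V ℝ := fun u v => (if H.Adj u v then 1 else 0) - D / N
  have quad (y : V → ℝ) : dotProduct y (M.mulVec y) =
      ∑ u, ∑ v, (if H.Adj u v then (1 : ℝ) else 0) * (y u * y v) - D / N * (∑ u, y u) ^ 2 := by
    rw [sq, Finset.sum_mul_sum, Finset.mul_sum, ← Finset.sum_sub_distrib]
    refine Finset.sum_congr rfl fun u _ => ?_
    rw [Finset.mul_sum, ← Finset.sum_sub_distrib, Matrix.mulVec, dotProduct, Finset.mul_sum]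
    exact Finset.sum_congr rfl fun v _ => by simp only [M]; ring
  obtain ⟨T, hT⟩ := exists_indicator_quadratic_le M
    (fun z => by simp only [M, SimpleGraph.irrefl, if_false]; simp; positivity)
    (fun z => 1 - t z) (fun z => by linarith [ht1 z]) (fun z => by linarith [ht0 z])
  refine ⟨T, ?_⟩
  rw [quad, quad, ← two_mul_edgesIn] at hT
  have hcard : ∑ u : V, (if u ∈ T then (1 : ℝ) else 0) = T.card := by simp
  have hsum : ∑ u : V, (1 - t u) = N - ∑ u, t u := by simp [Finset.sum_sub_distrib, hNdef]
  rw [hcard, hsum] at hT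
  have hsq : N * D - 2 * D * ∑ u, t u ≤ D / N * (N - ∑ u, t u) ^ 2 := by
    have : D / N * (N - ∑ u, t u) ^ 2 =
        N * D - 2 * D * ∑ u, t u + D / N * (∑ u, t u) ^ 2 := by
      field_simp
      ring
    rw [this]
    linarith [mul_nonneg (div_pos hD hNpos).le (sq_nonneg (∑ u, t u))]
  have hgain : S / (380 * D ^ 2) ≤
      ∑ u, (2 * ((degC H u : ℝ) - D) * t u - (degC H u : ℝ) * t u ^ 2) := by
    rw [hS, Finset.sum_div]
    refine Finset.sum_le_sum fun u _ => ?_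
    simp only [t]
    split_ifs with h
    · exact cube_excess_le hD h
    · simp
  have hsplit : ∑ u, (degC H u : ℝ) * (1 - 2 * t u + t u ^ 2) = 2 * edgeCount H -
      2 * D * ∑ u, t u -
        ∑ u, (2 * ((degC H u : ℝ) - D) * t u - (degC H u : ℝ) * t u ^ 2) := by
    rw [← sum_degC, Finset.mul_sum, ← Finset.sum_sub_distrib, ← Finset.sum_sub_distrib]
    exact Finset.sum_congr rfl fun u _ => by ring
  have hadj := sum_adj_mul_one_sub_le H t
  have e1 : 1 / 1520 / D ^ 2 * S = S / (380 * D ^ 2) / 4 := by ring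
  have e2 : (T.card : ℝ) ^ 2 / 2 * (D / N) = D / N * (T.card : ℝ) ^ 2 / 2 := by ring
  rw [e1] at hE ⊢
  rw [e2]
  linarith

end MaxCutPaper
end

section
/- Let G be a d-regular finite simple graph on n ≥ 1 vertices and let S ⊆ V(G). Then the surplus of G satisfies sp(G) ≥ (1/2) · ( (|S|²/2)·(d/n) − e_G(S) ), where e_G(S) denotes the number of edges of G with both endpoints in S. -/
namespace MaxCutPaper

variable {V : Type*}

open scoped Matrix

open Classical in
/-- Changing one coordinate of the quadratic form of an adjacency matrix. -/
theorem dotProduct_adjMatrix_mulVec_add_single [Fintype V] (G : SimpleGraph V) (y : V → ℝ)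
    (a : V) (c : ℝ) :
    (y + Pi.single a c) ⬝ᵥ (G.adjMatrix ℝ *ᵥ (y + Pi.single a c)) =
      y ⬝ᵥ (G.adjMatrix ℝ *ᵥ y) + 2 * c * (G.adjMatrix ℝ *ᵥ y) a := by
  have h : y ⬝ᵥ (G.adjMatrix ℝ *ᵥ Pi.single a c) = c * (G.adjMatrix ℝ *ᵥ y) a := by
    rw [Matrix.dotProduct_mulVec, dotProduct_single, ← Matrix.mulVec_transpose,
      G.transpose_adjMatrix, mul_comm]
  have h' : (Pi.single a c : V → ℝ) ⬝ᵥ (G.adjMatrix ℝ *ᵥ Pi.single a c) = 0 := by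
    simp [single_dotProduct, Matrix.mulVec_single]
  rw [Matrix.mulVec_add, add_dotProduct, dotProduct_add, dotProduct_add, h, h', single_dotProduct]
  ring

open Classical in
/-- The quadratic form of an adjacency matrix on the cube `[-1, 1]^V` can be decreased while
rounding the coordinates in `T` to `±1`. -/
theorem exists_rounding_on [Fintype V] (G : SimpleGraph V) (y : V → ℝ)
    (hy : ∀ v, |y v| ≤ 1) (T : Finset V) :
    ∃ x : V → ℝ, (∀ v, |x v| ≤ 1) ∧ (∀ v ∈ T, x v = 1 ∨ x v = -1) ∧
      x ⬝ᵥ (G.adjMatrix ℝ *ᵥ x) ≤ y ⬝ᵥ (G.adjMatrix ℝ *ᵥ y) := by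
  induction T using Finset.induction_on with
  | empty => exact ⟨y, hy, by simp, le_rfl⟩
  | insert a T ha ih =>
    obtain ⟨x, hx, hT, hQ⟩ := ih
    obtain ⟨t, ht, hle⟩ : ∃ t : ℝ, (t = 1 ∨ t = -1) ∧
        (t - x a) * (G.adjMatrix ℝ *ᵥ x) a ≤ 0 := by
      have hxa := abs_le.mp (hx a)
      rcases le_total ((G.adjMatrix ℝ *ᵥ x) a) 0 with h | h
      · exact ⟨1, Or.inl rfl, mul_nonpos_of_nonneg_of_nonpos (by linarith) h⟩
      · exact ⟨-1, Or.inr rfl, mul_nonpos_of_nonpos_of_nonneg (by linarith) h⟩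
    have hself : (x + Pi.single a (t - x a) : V → ℝ) a = t := by simp
    have hne : ∀ v, v ≠ a → (x + Pi.single a (t - x a) : V → ℝ) v = x v := fun v hv => by simp [hv]
    refine ⟨x + Pi.single a (t - x a), fun v => ?_, fun v hv => ?_, ?_⟩
    · by_cases hva : v = a
      · subst hva
        rw [hself]
        rcases ht with rfl | rfl <;> simp
      · rw [hne v hva]
        exact hx v
    · by_cases hva : v = a
      · subst hva
        rwa [hself]
      · rw [hne v hva]
        exact hT v (Finset.mem_of_mem_insert_of_ne hv hva)
    · rw [dotProduct_adjMatrix_mulVec_add_single]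
      linarith

open Classical in
theorem dotProduct_adjMatrix_mulVec_eq_sum [Fintype V] (G : SimpleGraph V) (f g : V → ℝ) :
    f ⬝ᵥ (G.adjMatrix ℝ *ᵥ g) = ∑ u, ∑ v, if G.Adj u v then f u * g v else 0 := by
  simp only [dotProduct, Matrix.mulVec, SimpleGraph.adjMatrix_apply, Finset.mul_sum]
  refine Finset.sum_congr rfl fun u _ => Finset.sum_congr rfl fun v _ => ?_
  split_ifs <;> simp

open Classical in
/-- Counting adjacent ordered pairs via the bilinear form of the adjacency matrix. -/
theorem natCard_adj_pairs [Fintype V] (G : SimpleGraph V) (P Q : V → Prop)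
    [DecidablePred P] [DecidablePred Q] :
    (Nat.card {p : V × V // P p.1 ∧ Q p.2 ∧ G.Adj p.1 p.2} : ℝ) =
      (fun v => if P v then (1 : ℝ) else 0) ⬝ᵥ
        (G.adjMatrix ℝ *ᵥ fun v => if Q v then (1 : ℝ) else 0) := by
  rw [dotProduct_adjMatrix_mulVec_eq_sum, Nat.card_eq_fintype_card, Fintype.card_subtype,
    Finset.card_filter, Fintype.sum_prod_type]
  push_cast
  refine Finset.sum_congr rfl fun u _ => Finset.sum_congr rfl fun v _ => ?_
  by_cases h1 : P u <;> by_cases h2 : Q v <;> by_cases h3 : G.Adj u v <;> simp [h1, h2, h3]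

open Classical in
theorem dotProduct_adjMatrix_mulVec_comm [Fintype V] (G : SimpleGraph V) (f g : V → ℝ) :
    f ⬝ᵥ (G.adjMatrix ℝ *ᵥ g) = g ⬝ᵥ (G.adjMatrix ℝ *ᵥ f) := by
  rw [Matrix.dotProduct_mulVec, ← Matrix.mulVec_transpose, G.transpose_adjMatrix, dotProduct_comm]

open Classical in
theorem adjMatrix_mulVec_one_apply [Fintype V] (G : SimpleGraph V) (v : V) :
    (G.adjMatrix ℝ *ᵥ 1) v = degC G v := by
  rw [degC, Nat.card_eq_fintype_card, SimpleGraph.card_neighborSet_eq_degree,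
    SimpleGraph.adjMatrix_mulVec_apply]
  simp

open Classical in
theorem two_mul_edgeCount [Fintype V] (G : SimpleGraph V) :
    2 * (edgeCount G : ℝ) = 1 ⬝ᵥ (G.adjMatrix ℝ *ᵥ 1) := by
  have h := G.sum_degrees_eq_twice_card_edges
  rw [edgeCount, Nat.card_eq_fintype_card, ← SimpleGraph.edgeFinset_card, one_dotProduct]
  simp only [adjMatrix_mulVec_one_apply, degC, Nat.card_eq_fintype_card,
    SimpleGraph.card_neighborSet_eq_degree]
  exact_mod_cast h.symm

open Classical in
/-- Every point of the cube `[-1, 1]^V` gives a lower bound for the surplus. -/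
theorem neg_dotProduct_adjMatrix_mulVec_le_surplus [Fintype V] (G : SimpleGraph V) (y : V → ℝ)
    (hy : ∀ v, |y v| ≤ 1) :
    -(y ⬝ᵥ (G.adjMatrix ℝ *ᵥ y)) / 4 ≤ surplus G := by
  obtain ⟨x, -, hx, hQ⟩ := exists_rounding_on G y hy Finset.univ
  set T : Finset V := {v | x v = 1} with hTdef
  have hcut : (cutSize G T : ℝ) ≤ maxCut G := by
    exact_mod_cast Finset.le_sup (f := cutSize G) (by simp : T ∈ Finset.univ.powerset)
  have hP : (fun v => if v ∈ T then (1 : ℝ) else 0) = (1 / 2 : ℝ) • (1 + x) := by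
    ext v
    rcases hx v (Finset.mem_univ v) with h | h <;> norm_num [hTdef, h]
  have hN : (fun v => if v ∉ T then (1 : ℝ) else 0) = (1 / 2 : ℝ) • (1 - x) := by
    ext v
    rcases hx v (Finset.mem_univ v) with h | h <;> norm_num [hTdef, h]
  have hcard : (cutSize G T : ℝ) =
      (1 ⬝ᵥ (G.adjMatrix ℝ *ᵥ 1) - x ⬝ᵥ (G.adjMatrix ℝ *ᵥ x)) / 4 := by
    rw [cutSize, natCard_adj_pairs G (· ∈ T) (· ∉ T), hP, hN, Matrix.mulVec_smul,
      smul_dotProduct, dotProduct_smul, Matrix.mulVec_sub, add_dotProduct, dotProduct_sub,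
      dotProduct_sub, dotProduct_adjMatrix_mulVec_comm G x 1, smul_eq_mul, smul_eq_mul]
    ring
  have he := two_mul_edgeCount G
  rw [surplus]
  linarith

/-- If `G` is `d`-regular on `n ≥ 1` vertices and `S ⊆ V(G)`, then
`sp(G) ≥ (1/2)·((|S|²/2)·(d/n) - e_G(S))`. -/
theorem statement19 (V : Type) [Fintype V] (G : SimpleGraph V) (d : ℕ)
    (hn : 1 ≤ Fintype.card V) (hreg : ∀ v : V, degC G v = d) (S : Finset V) :
    surplus G ≥ (1 : ℝ) / 2 *
      ((S.card : ℝ) ^ 2 / 2 * ((d : ℝ) / (Fintype.card V : ℝ)) - edgesIn G S) := by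
  classical
  have hn0 : (0 : ℝ) < Fintype.card V := by exact_mod_cast hn
  have hSn : (S.card : ℝ) ≤ Fintype.card V := by exact_mod_cast S.card_le_univ
  have hc0 : 0 ≤ (S.card : ℝ) / Fintype.card V := by positivity
  have hc1 : (S.card : ℝ) / Fintype.card V ≤ 1 := (div_le_one hn0).mpr hSn
  set c : ℝ := (S.card : ℝ) / Fintype.card V with hc
  set f : V → ℝ := fun v => if v ∈ S then 1 else 0 with hf
  have hone : G.adjMatrix ℝ *ᵥ 1 = (d : ℝ) • (1 : V → ℝ) := by
    ext v
    rw [adjMatrix_mulVec_one_apply, hreg]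
    simp
  have hS : edgesIn G S = f ⬝ᵥ (G.adjMatrix ℝ *ᵥ f) / 2 := by
    rw [edgesIn, natCard_adj_pairs G (· ∈ S) (· ∈ S)]
  have hf1 : f ⬝ᵥ (1 : V → ℝ) = S.card := by
    simp [dotProduct_one, hf]
  have h11 : (1 : V → ℝ) ⬝ᵥ 1 = Fintype.card V := by
    simp [dotProduct_one]
  have hQ : (f - c • 1) ⬝ᵥ (G.adjMatrix ℝ *ᵥ (f - c • 1)) =
      2 * edgesIn G S - 2 * c * d * S.card + c ^ 2 * d * Fintype.card V := by
    rw [hS, Matrix.mulVec_sub, Matrix.mulVec_smul, sub_dotProduct, dotProduct_sub,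
      dotProduct_sub, smul_dotProduct, smul_dotProduct, dotProduct_adjMatrix_mulVec_comm G 1 f,
      hone]
    simp only [dotProduct_smul, hf1, h11, smul_eq_mul]
    ring
  have hb := neg_dotProduct_adjMatrix_mulVec_le_surplus G (f - c • 1) fun v => by
    rw [abs_le]
    by_cases hv : v ∈ S <;> simp [hf, hv] <;> constructor <;> linarith
  rw [hQ] at hb
  refine le_trans (le_of_eq ?_) hb
  rw [hc]
  field_simp
  ring

end MaxCutPaper
end
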